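/- The function I(x) = h_x(z(x)) is twice differentiable on (0,1) and, as x → 0⁺, I″(x) / ( (α^{1/(1−α)}/(1−α)) · x^{(2α−1)/(1−α)} ) → 1. Consequently I″(x) → +∞ as x → 0⁺ when α ∈ (0,1/2), I″(x) → 1/2 when α = 1/2, and I″(x) → 0 when α ∈ (1/2,1), exhibiting a second-order phase transition at α = 1/2. -/

import Mathlib

open Filter Topology

/-- The function `h_x(z) = ln z - x ln(1-(1-z)^α)` for `z ∈ (0,1)`. -/
noncomputable def hfun (α x : ℝ) : ℝ → ℝ :=
  fun z => Real.log z - x * Real.log (1 - (1 - z) ^ α)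

/-- The rate function `I(x) = h_x(z(x))`, where `zf` is the saddle-point map. -/
noncomputable def Ifun (α : ℝ) (zf : ℝ → ℝ) : ℝ → ℝ :=
  fun x => hfun α x (zf x)

/-- The value of `x` for which `1 - w` is the critical point of `h_x`. -/
noncomputable def saddleParam (α w : ℝ) : ℝ :=
  (w ^ (1 - α) - w) / (α * (1 - w))

section

variable {α w : ℝ}

lemma rpow_lt_tangent (hα : α ∈ Set.Ioo (0 : ℝ) 1) (hw : w ∈ Set.Ioo (0 : ℝ) 1) :
    w ^ α < 1 - α + α * w := by
  have h := rpow_one_add_lt_one_add_mul_self (s := w - 1) (p := α)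
    (by linarith [hw.1]) (by linarith [hw.2]) hα.1 hα.2
  rw [add_sub_cancel] at h
  linarith

lemma hasDerivAt_hfun (hα : α ∈ Set.Ioo (0 : ℝ) 1) (hw : w ∈ Set.Ioo (0 : ℝ) 1) (x : ℝ) :
    HasDerivAt (hfun α x) (1 / (1 - w) - x * (α * w ^ (α - 1) / (1 - w ^ α))) (1 - w) := by
  have hlt : w ^ α < 1 := Real.rpow_lt_one hw.1.le hw.2 hα.1
  have h1 : HasDerivAt (fun z : ℝ => 1 - z) (-1) (1 - w) := (hasDerivAt_id _).const_sub 1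
  have h2 := h1.rpow_const (p := α) (Or.inl (by simpa using hw.1.ne'))
  have h3 := (h2.const_sub 1).log (by simpa using (sub_pos.2 hlt).ne')
  have h4 := (Real.hasDerivAt_log (sub_pos.2 hw.2).ne').sub (h3.const_mul x)
  refine h4.congr_deriv ?_
  simp only [sub_sub_cancel]
  ring

lemma saddleParam_eq (hw : w ∈ Set.Ioo (0 : ℝ) 1) :
    saddleParam α w = w ^ (1 - α) / α * ((1 - w ^ α) / (1 - w)) := by
  have h : w ^ (1 - α) * w ^ α = w := by
    rw [← Real.rpow_add hw.1]; simp
  rw [saddleParam, div_mul_div_comm, mul_one_sub (w ^ (1 - α)), h]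

lemma saddleParam_pos (hα : α ∈ Set.Ioo (0 : ℝ) 1) (hw : w ∈ Set.Ioo (0 : ℝ) 1) :
    0 < saddleParam α w := by
  rw [saddleParam_eq hw]
  exact mul_pos (div_pos (Real.rpow_pos_of_pos hw.1 _) hα.1)
    (div_pos (sub_pos.2 (Real.rpow_lt_one hw.1.le hw.2 hα.1)) (sub_pos.2 hw.2))

/-- A critical point `1 - w` of `h_x` satisfies `x = saddleParam α w`. -/
lemma saddleParam_eq_of_deriv_eq_zero (hα : α ∈ Set.Ioo (0 : ℝ) 1)
    (hw : w ∈ Set.Ioo (0 : ℝ) 1) {x : ℝ} (h : deriv (hfun α x) (1 - w) = 0) :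
    saddleParam α w = x := by
  rw [(hasDerivAt_hfun hα hw x).deriv] at h
  have hlt : 0 < 1 - w ^ α := sub_pos.2 (Real.rpow_lt_one hw.1.le hw.2 hα.1)
  have h1w : 0 < 1 - w := sub_pos.2 hw.2
  have hα0 := hα.1
  have hp : w ^ (α - 1) * w ^ (1 - α) = 1 := by
    rw [← Real.rpow_add hw.1]; simp
  rw [saddleParam_eq hw]
  field_simp at h ⊢
  linear_combination w ^ (1 - α) * h + x * α * (1 - w) * hp

lemma hasDerivAt_saddleParam (hα : α ∈ Set.Ioo (0 : ℝ) 1) (hw : w ∈ Set.Ioo (0 : ℝ) 1) :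
    HasDerivAt (saddleParam α)
      (w ^ (-α) * (1 - α + α * w - w ^ α) / (α * (1 - w) ^ 2)) w := by
  have h1w : 1 - w ≠ 0 := (sub_pos.2 hw.2).ne'
  have hα0 := hα.1.ne'
  have h1 := (Real.hasDerivAt_rpow_const (p := 1 - α) (Or.inl hw.1.ne')).sub (hasDerivAt_id w)
  have h2 := ((hasDerivAt_id w).const_sub 1).const_mul α
  have h3 := h1.div h2 (mul_ne_zero hα0 h1w)
  refine h3.congr_deriv ?_
  have e1 : (1 - α - 1 : ℝ) = -α := by ring
  have e2 : w ^ (1 - α) = w * w ^ (-α) := by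
    rw [sub_eq_add_neg, Real.rpow_add hw.1, Real.rpow_one]
  have e3 : w ^ (-α) * w ^ α = 1 := by
    rw [← Real.rpow_add hw.1]; simp
  simp only [id, Pi.sub_apply, e1, e2]
  field_simp
  linear_combination e3

lemma saddleParam_strictMonoOn (hα : α ∈ Set.Ioo (0 : ℝ) 1) :
    StrictMonoOn (saddleParam α) (Set.Ioo 0 1) := by
  refine strictMonoOn_of_deriv_pos (convex_Ioo 0 1)
    (fun w hw => (hasDerivAt_saddleParam hα hw).continuousAt.continuousWithinAt) fun w hw => ?_
  rw [interior_Ioo] at hw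
  rw [(hasDerivAt_saddleParam hα hw).deriv]
  exact div_pos (mul_pos (Real.rpow_pos_of_pos hw.1 _) (sub_pos.2 (rpow_lt_tangent hα hw)))
    (mul_pos hα.1 (pow_pos (sub_pos.2 hw.2) 2))

end

section

variable {α : ℝ} {v : ℝ → ℝ}

lemma tendsto_saddle_inverse_zero (hα : α ∈ Set.Ioo (0 : ℝ) 1)
    (hv : ∀ x ∈ Set.Ioo (0 : ℝ) 1, v x ∈ Set.Ioo (0 : ℝ) 1)
    (hvx : ∀ x ∈ Set.Ioo (0 : ℝ) 1, saddleParam α (v x) = x) :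
    Tendsto v (𝓝[>] 0) (𝓝[>] 0) := by
  have hIoo : ∀ᶠ x in 𝓝[>] (0 : ℝ), x ∈ Set.Ioo (0 : ℝ) 1 := Ioo_mem_nhdsGT one_pos
  refine tendsto_nhdsWithin_iff.2 ⟨?_, hIoo.mono fun x hx => (hv x hx).1⟩
  refine tendsto_order.2 ⟨fun a ha => hIoo.mono fun x hx => ha.trans (hv x hx).1, fun b hb => ?_⟩
  obtain ⟨c, hc0, hc⟩ := exists_between (lt_min hb one_pos)
  have hc' : c ∈ Set.Ioo (0 : ℝ) 1 := ⟨hc0, hc.trans_le (min_le_right _ _)⟩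
  filter_upwards [hIoo, Ioo_mem_nhdsGT (saddleParam_pos hα hc')] with x hx hxc
  refine lt_trans ?_ (hc.trans_le (min_le_left _ _))
  rw [← (saddleParam_strictMonoOn hα).lt_iff_lt (hv x hx) hc', hvx x hx]
  exact hxc.2

lemma continuousAt_saddle_inverse (hα : α ∈ Set.Ioo (0 : ℝ) 1)
    (hv : ∀ x ∈ Set.Ioo (0 : ℝ) 1, v x ∈ Set.Ioo (0 : ℝ) 1)
    (hvx : ∀ x ∈ Set.Ioo (0 : ℝ) 1, saddleParam α (v x) = x) {x : ℝ}
    (hx : x ∈ Set.Ioo (0 : ℝ) 1) : ContinuousAt v x := by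
  have hmono := saddleParam_strictMonoOn hα
  have hIoo : ∀ᶠ y in 𝓝 x, y ∈ Set.Ioo (0 : ℝ) 1 := Ioo_mem_nhds hx.1 hx.2
  refine tendsto_order.2 ⟨fun a ha => ?_, fun b hb => ?_⟩
  · obtain ⟨c, hc, hcv⟩ := exists_between (max_lt ha (hv x hx).1)
    have hc' : c ∈ Set.Ioo (0 : ℝ) 1 :=
      ⟨(le_max_right _ _).trans_lt hc, hcv.trans (hv x hx).2⟩
    have hlt := hmono hc' (hv x hx) hcv
    rw [hvx x hx] at hlt
    filter_upwards [hIoo, lt_mem_nhds hlt] with y hy hcy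
    refine ((le_max_left _ _).trans_lt hc).trans ?_
    rwa [← hmono.lt_iff_lt hc' (hv y hy), hvx y hy]
  · obtain ⟨c, hcv, hc⟩ := exists_between (lt_min hb (hv x hx).2)
    have hc' : c ∈ Set.Ioo (0 : ℝ) 1 :=
      ⟨(hv x hx).1.trans hcv, hc.trans_le (min_le_right _ _)⟩
    have hlt := hmono (hv x hx) hc' hcv
    rw [hvx x hx] at hlt
    filter_upwards [hIoo, gt_mem_nhds hlt] with y hy hcy
    refine lt_trans ?_ (hc.trans_le (min_le_left _ _))
    rwa [← hmono.lt_iff_lt (hv y hy) hc', hvx y hy]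

lemma hasDerivAt_saddle_inverse (hα : α ∈ Set.Ioo (0 : ℝ) 1)
    (hv : ∀ x ∈ Set.Ioo (0 : ℝ) 1, v x ∈ Set.Ioo (0 : ℝ) 1)
    (hvx : ∀ x ∈ Set.Ioo (0 : ℝ) 1, saddleParam α (v x) = x) {x : ℝ}
    (hx : x ∈ Set.Ioo (0 : ℝ) 1) :
    HasDerivAt v
      (v x ^ (-α) * (1 - α + α * v x - v x ^ α) / (α * (1 - v x) ^ 2))⁻¹ x := by
  have hw := hv x hx
  refine (hasDerivAt_saddleParam hα hw).of_local_left_inverse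
    (continuousAt_saddle_inverse hα hv hvx hx) ?_
    (Filter.mem_of_superset (Ioo_mem_nhds hx.1 hx.2) hvx)
  exact (div_pos (mul_pos (Real.rpow_pos_of_pos hw.1 _) (sub_pos.2 (rpow_lt_tangent hα hw)))
    (mul_pos hα.1 (pow_pos (sub_pos.2 hw.2) 2))).ne'

/-- Envelope formula: only the explicit dependence of `h_x` on `x` contributes to `I'`. -/
lemma hasDerivAt_Ifun {zf : ℝ → ℝ} (hα : α ∈ Set.Ioo (0 : ℝ) 1) {x z' : ℝ}
    (hz : zf x ∈ Set.Ioo (0 : ℝ) 1) (hzf : HasDerivAt zf z' x)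
    (h : deriv (hfun α x) (zf x) = 0) :
    HasDerivAt (Ifun α zf) (-Real.log (1 - (1 - zf x) ^ α)) x := by
  have hw : 1 - zf x ∈ Set.Ioo (0 : ℝ) 1 := ⟨by linarith [hz.2], by linarith [hz.1]⟩
  have hlt : 0 < 1 - (1 - zf x) ^ α := sub_pos.2 (Real.rpow_lt_one hw.1.le hw.2 hα.1)
  have hcrit := (hasDerivAt_hfun hα hw x).deriv
  rw [sub_sub_cancel, h] at hcrit
  have h1 := (((hzf.const_sub 1).rpow_const (p := α) (Or.inl hw.1.ne')).const_sub 1).log hlt.ne'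
  have h2 := (hzf.log hz.1.ne').sub ((hasDerivAt_id x).mul h1)
  refine h2.congr_deriv ?_
  simp only [id]
  linear_combination -z' * hcrit

lemma hasDerivAt_neg_log_one_sub_rpow (hα : α ∈ Set.Ioo (0 : ℝ) 1)
    (hv : ∀ x ∈ Set.Ioo (0 : ℝ) 1, v x ∈ Set.Ioo (0 : ℝ) 1)
    (hvx : ∀ x ∈ Set.Ioo (0 : ℝ) 1, saddleParam α (v x) = x) {x : ℝ}
    (hx : x ∈ Set.Ioo (0 : ℝ) 1) :
    HasDerivAt (fun y => -Real.log (1 - v y ^ α))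
      (α ^ 2 * v x ^ (2 * α - 1) * ((1 - v x) ^ 2 /
        ((1 - v x ^ α) * (1 - α + α * v x - v x ^ α)))) x := by
  have hw := hv x hx
  have hlt : 0 < 1 - v x ^ α := sub_pos.2 (Real.rpow_lt_one hw.1.le hw.2 hα.1)
  have htan := sub_pos.2 (rpow_lt_tangent hα hw)
  have h1w : 0 < 1 - v x := sub_pos.2 hw.2
  have hα0 := hα.1
  have hd := (((hasDerivAt_saddle_inverse hα hv hvx hx).rpow_const (p := α)
    (Or.inl hw.1.ne')).const_sub 1).log hlt.ne'
  refine hd.neg.congr_deriv ?_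
  have hpos := Real.rpow_pos_of_pos hw.1 (-α)
  have e : v x ^ (α - 1) = v x ^ (2 * α - 1) * v x ^ (-α) := by
    rw [← Real.rpow_add hw.1]; ring_nf
  rw [e]
  field_simp

end

/-- With `x = saddleParam α w`, the second derivative of the rate function divided by its
asymptotic form is a function of `w` that is continuous at `0`. -/
lemma secondDeriv_div_asymptotic {α w : ℝ} (hα : α ∈ Set.Ioo (0 : ℝ) 1)
    (hw : w ∈ Set.Ioo (0 : ℝ) 1) :
    α ^ 2 * w ^ (2 * α - 1) * ((1 - w) ^ 2 / ((1 - w ^ α) * (1 - α + α * w - w ^ α))) /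
        ((α ^ (1 / (1 - α)) / (1 - α)) * saddleParam α w ^ ((2 * α - 1) / (1 - α))) =
      (1 - α) * ((1 - w) ^ 2 / ((1 - w ^ α) * (1 - α + α * w - w ^ α))) /
        ((1 - w ^ α) / (1 - w)) ^ ((2 * α - 1) / (1 - α)) := by
  have hα0 := hα.1
  have h1α : 0 < 1 - α := sub_pos.2 hα.2
  have hlt : 0 < 1 - w ^ α := sub_pos.2 (Real.rpow_lt_one hw.1.le hw.2 hα.1)
  have h1w : 0 < 1 - w := sub_pos.2 hw.2
  have hq := div_pos hlt h1w
  have hp := Real.rpow_pos_of_pos hw.1 (1 - α)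
  rw [saddleParam_eq hw, Real.mul_rpow (div_pos hp hα0).le hq.le,
    Real.div_rpow hp.le hα0.le, ← Real.rpow_mul hw.1.le, mul_div_cancel₀ _ h1α.ne']
  have e : α ^ (1 / (1 - α)) = α ^ 2 * α ^ ((2 * α - 1) / (1 - α)) := by
    rw [← Real.rpow_natCast, ← Real.rpow_add hα0]
    congr 1
    field_simp
    push_cast
    ring
  rw [e]
  have h1 := Real.rpow_pos_of_pos hα0 ((2 * α - 1) / (1 - α))
  have h2 := Real.rpow_pos_of_pos hw.1 (2 * α - 1)
  have h3 := Real.rpow_pos_of_pos hq ((2 * α - 1) / (1 - α))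
  generalize α ^ ((2 * α - 1) / (1 - α)) = A at *
  generalize ((1 - w ^ α) / (1 - w)) ^ ((2 * α - 1) / (1 - α)) = B at *
  generalize (1 - w) ^ 2 / ((1 - w ^ α) * (1 - α + α * w - w ^ α)) = C
  generalize w ^ (2 * α - 1) = D at *
  field_simp

lemma tendsto_secondDeriv_ratio {α : ℝ} (hα : α ∈ Set.Ioo (0 : ℝ) 1) (β : ℝ) :
    Tendsto (fun w : ℝ =>
      (1 - α) * ((1 - w) ^ 2 / ((1 - w ^ α) * (1 - α + α * w - w ^ α))) /
        ((1 - w ^ α) / (1 - w)) ^ β) (𝓝 0) (𝓝 1) := by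
  have h0 : (0 : ℝ) ^ α = 0 := Real.zero_rpow hα.1.ne'
  have h1α : 1 - α ≠ 0 := (sub_pos.2 hα.2).ne'
  have hr : ContinuousAt (fun w : ℝ => w ^ α) 0 :=
    Real.continuousAt_rpow_const _ _ (Or.inr hα.1.le)
  have hc : ContinuousAt (fun w : ℝ =>
      (1 - α) * ((1 - w) ^ 2 / ((1 - w ^ α) * (1 - α + α * w - w ^ α))) /
        ((1 - w ^ α) / (1 - w)) ^ β) 0 := by
    refine ContinuousAt.div (continuousAt_const.mul (ContinuousAt.div (by fun_prop)
      (by fun_prop) (by simpa [h0] using h1α))) (ContinuousAt.rpow_const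
      (ContinuousAt.div (by fun_prop) (by fun_prop) (by simp)) (Or.inl ?_)) ?_ <;> simp [h0]
  convert hc.tendsto using 2
  simp [h0, h1α]

/-- `I` is twice differentiable on `(0,1)` and, as `x → 0⁺`,
`I''(x) / ((α^{1/(1-α)}/(1-α)) x^{(2α-1)/(1-α)}) → 1`; consequently `I''(x) → +∞`
when `α ∈ (0,1/2)`, `I''(x) → 1/2` when `α = 1/2`, and `I''(x) → 0` when
`α ∈ (1/2,1)`: a second-order phase transition at `α = 1/2`. -/
theorem rate_function_second_derivative_phase_transition (α : ℝ)
    (hα : α ∈ Set.Ioo (0 : ℝ) 1) (zf : ℝ → ℝ)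
    (hzf : ∀ x ∈ Set.Ioo (0 : ℝ) 1, zf x ∈ Set.Ioo (0 : ℝ) 1 ∧
      deriv (hfun α x) (zf x) = 0) :
    (∀ x ∈ Set.Ioo (0 : ℝ) 1, DifferentiableAt ℝ (Ifun α zf) x) ∧
    (∀ x ∈ Set.Ioo (0 : ℝ) 1, DifferentiableAt ℝ (deriv (Ifun α zf)) x) ∧
    Tendsto (fun x : ℝ => deriv (deriv (Ifun α zf)) x /
        ((α ^ (1 / (1 - α)) / (1 - α)) * x ^ ((2 * α - 1) / (1 - α))))
      (𝓝[>] 0) (𝓝 1) ∧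
    (α < 1 / 2 → Tendsto (fun x : ℝ => deriv (deriv (Ifun α zf)) x) (𝓝[>] 0) atTop) ∧
    (α = 1 / 2 → Tendsto (fun x : ℝ => deriv (deriv (Ifun α zf)) x) (𝓝[>] 0)
      (𝓝 (1 / 2))) ∧
    (1 / 2 < α → Tendsto (fun x : ℝ => deriv (deriv (Ifun α zf)) x) (𝓝[>] 0)
      (𝓝 0)) := by
  have hv : ∀ x ∈ Set.Ioo (0 : ℝ) 1, 1 - zf x ∈ Set.Ioo (0 : ℝ) 1 := fun x hx =>
    ⟨by linarith [(hzf x hx).1.2], by linarith [(hzf x hx).1.1]⟩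
  have hvx : ∀ x ∈ Set.Ioo (0 : ℝ) 1, saddleParam α (1 - zf x) = x := fun x hx =>
    saddleParam_eq_of_deriv_eq_zero hα (hv x hx) (by simpa using (hzf x hx).2)
  have hd1 : ∀ x ∈ Set.Ioo (0 : ℝ) 1,
      HasDerivAt (Ifun α zf) (-Real.log (1 - (1 - zf x) ^ α)) x := fun x hx =>
    hasDerivAt_Ifun hα (hzf x hx).1
      (by simpa using (hasDerivAt_saddle_inverse hα hv hvx hx).const_sub 1) (hzf x hx).2
  have hd2 : ∀ x ∈ Set.Ioo (0 : ℝ) 1, HasDerivAt (deriv (Ifun α zf)) _ x := fun x hx =>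
    (hasDerivAt_neg_log_one_sub_rpow hα hv hvx hx).congr_of_eventuallyEq
      (Filter.mem_of_superset (Ioo_mem_nhds hx.1 hx.2) fun y hy => (hd1 y hy).deriv)
  have hIoo : ∀ᶠ x in 𝓝[>] (0 : ℝ), x ∈ Set.Ioo (0 : ℝ) 1 := Ioo_mem_nhdsGT one_pos
  have hratio : Tendsto (fun x : ℝ => deriv (deriv (Ifun α zf)) x /
        ((α ^ (1 / (1 - α)) / (1 - α)) * x ^ ((2 * α - 1) / (1 - α)))) (𝓝[>] 0) (𝓝 1) := by
    refine ((tendsto_secondDeriv_ratio hα ((2 * α - 1) / (1 - α))).comp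
      ((tendsto_saddle_inverse_zero hα hv hvx).mono_right nhdsWithin_le_nhds)).congr' ?_
    filter_upwards [hIoo] with x hx
    have h := secondDeriv_div_asymptotic hα (hv x hx)
    rw [hvx x hx] at h
    rw [(hd2 x hx).deriv, h, Function.comp_apply]
  have h1α : 0 < 1 - α := sub_pos.2 hα.2
  have hC : 0 < α ^ (1 / (1 - α)) / (1 - α) := div_pos (Real.rpow_pos_of_pos hα.1 _) h1α
  have hmul : (fun x : ℝ => deriv (deriv (Ifun α zf)) x /
        ((α ^ (1 / (1 - α)) / (1 - α)) * x ^ ((2 * α - 1) / (1 - α))) *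
        ((α ^ (1 / (1 - α)) / (1 - α)) * x ^ ((2 * α - 1) / (1 - α)))) =ᶠ[𝓝[>] 0]
      fun x => deriv (deriv (Ifun α zf)) x := by
    filter_upwards [hIoo] with x hx
    exact div_mul_cancel₀ _ (mul_pos hC (Real.rpow_pos_of_pos hx.1 _)).ne'
  refine ⟨fun x hx => (hd1 x hx).differentiableAt, fun x hx => (hd2 x hx).differentiableAt,
    hratio, fun h => ?_, fun h => ?_, fun h => ?_⟩
  · refine (hratio.pos_mul_atTop one_pos (Tendsto.const_mul_atTop hC ?_)).congr' hmul
    exact tendsto_rpow_neg_nhdsGT_zero (div_neg_of_neg_of_pos (by linarith) h1α)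
  · subst h
    refine Tendsto.congr' hmul ?_
    convert hratio.mul_const (1 / 2 : ℝ) using 2 <;> norm_num
  · have hβ : 0 < (2 * α - 1) / (1 - α) := div_pos (by linarith) h1α
    have h0 := ((Real.continuousAt_rpow_const 0 _ (Or.inr hβ.le)).tendsto.mono_left
      (nhdsWithin_le_nhds (s := Set.Ioi 0))).const_mul (α ^ (1 / (1 - α)) / (1 - α))
    refine Tendsto.congr' hmul ?_
    simpa [Real.zero_rpow hβ.ne'] using hratio.mul h0
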